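/- In the degree-corrected stochastic block model setting (Θ ∈ ℝ^{n×r} a normalized membership matrix, B ∈ ℝ^{r×r} nonnegative with no zero row or column, D₁, D₂ positive diagonal, A = D₁ Θ B Θᵀ D₂, P and Q the row-stochastic normalizations of A and Aᵀ, M = Θᵀ P Θ, N = Θᵀ Q Θ), if 0 ≤ β² < 1 and additionally B is invertible, then the unique solution X ∈ ℝ^{r×r} of X − (β²/2)(M X Mᵀ + N X Nᵀ) = Θᵀ(PPᵀ + QQᵀ)Θ is symmetric positive definite. -/

import Mathlib

open Matrix

/-- Size of the `p`-th block of the partition of `{1,…,n}` induced by the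
block-assignment map `blk`. -/
def blockSize {n r : ℕ} (blk : Fin n → Fin r) (p : Fin r) : ℕ :=
  (Finset.univ.filter fun i => blk i = p).card

/-- Normalized membership matrix `Θ ∈ ℝ^{n×r}`: the `p`-th column is
`(1/√n_p)·χ^(p)`, where `χ^(p)` is the characteristic vector of block `p`
and `n_p` its size. Its columns are orthonormal. -/
noncomputable def Theta {n r : ℕ} (blk : Fin n → Fin r) :
    Matrix (Fin n) (Fin r) ℝ :=
  Matrix.of fun i p =>
    if blk i = p then (Real.sqrt (blockSize blk p))⁻¹ else 0

/-- Row-stochastic normalization `D⁻¹ A` of a matrix `A`, where `D` is the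
diagonal matrix of the row sums of `A`. -/
noncomputable def rowNormalize {n : ℕ} (A : Matrix (Fin n) (Fin n) ℝ) :
    Matrix (Fin n) (Fin n) ℝ :=
  Matrix.diagonal (fun i => (∑ j, A i j)⁻¹) * A

/-! ### Discrete Lyapunov-type equations with nonnegative coefficients -/

/-- If `M` is nonnegative and fixes `w`, then `E ↦ M E Mᵀ` does not increase the entrywise bound
`|E p q| ≤ c * (w p * w q)`. -/
theorem abs_mul_mul_transpose_apply_le {ι : Type*} [Fintype ι] {M E : Matrix ι ι ℝ} {w : ι → ℝ}
    {c : ℝ} (hM : ∀ p q, 0 ≤ M p q) (hMw : M *ᵥ w = w)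
    (hE : ∀ p q, |E p q| ≤ c * (w p * w q)) (p q : ι) :
    |(M * E * Mᵀ) p q| ≤ c * (w p * w q) := by
  have hw (p : ι) : ∑ a, M p a * w a = w p := congrFun hMw p
  calc |(M * E * Mᵀ) p q| = |∑ b, ∑ a, M p a * E a b * M q b| := by
        simp [mul_apply, Finset.sum_mul]
    _ ≤ ∑ b, ∑ a, |M p a * E a b * M q b| :=
        (Finset.abs_sum_le_sum_abs _ _).trans
          (Finset.sum_le_sum fun b _ => Finset.abs_sum_le_sum_abs _ _)
    _ ≤ ∑ b, ∑ a, M p a * (c * (w a * w b)) * M q b := by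
        refine Finset.sum_le_sum fun b _ => Finset.sum_le_sum fun a _ => ?_
        rw [abs_mul, abs_mul, abs_of_nonneg (hM p a), abs_of_nonneg (hM q b)]
        exact mul_le_mul_of_nonneg_right (mul_le_mul_of_nonneg_left (hE a b) (hM p a)) (hM q b)
    _ = c * ((∑ a, M p a * w a) * ∑ b, M q b * w b) := by
        rw [Finset.sum_mul_sum, Finset.mul_sum, Finset.sum_comm]
        refine Finset.sum_congr rfl fun a _ => ?_
        rw [Finset.mul_sum]
        exact Finset.sum_congr rfl fun b _ => by ring
    _ = c * (w p * w q) := by rw [hw, hw]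

/-- An entrywise limit of positive semidefinite matrices is positive semidefinite. -/
theorem posSemidef_of_tendsto {ι : Type*} [Fintype ι] {Z : ℕ → Matrix ι ι ℝ} {X : Matrix ι ι ℝ}
    (hZ : ∀ k, (Z k).PosSemidef) (hlim : Filter.Tendsto Z Filter.atTop (nhds X)) :
    X.PosSemidef := by
  refine .of_dotProduct_mulVec_nonneg ?_ fun v => ?_
  · refine tendsto_nhds_unique ?_ hlim
    have h : Continuous fun Y : Matrix ι ι ℝ => Yᴴ := continuous_id.matrix_conjTranspose
    exact ((h.tendsto X).comp hlim).congr fun k => (hZ k).isHermitian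
  · have h : Continuous fun Y : Matrix ι ι ℝ => star v ⬝ᵥ Y *ᵥ v := by fun_prop
    exact ge_of_tendsto' ((h.tendsto X).comp hlim) fun k => (hZ k).dotProduct_mulVec_nonneg v

/-- If `M` and `N` are nonnegative and fix a common positive vector, then any solution of
`X = C + t (M X Mᵀ + N X Nᵀ)` with `0 ≤ t < 1 / 2` and `C` positive semidefinite is positive
semidefinite. -/
theorem posSemidef_of_eq_add_smul {ι : Type*} [Fintype ι] {M N C X : Matrix ι ι ℝ} {w : ι → ℝ}
    {t : ℝ} (hM : ∀ p q, 0 ≤ M p q) (hN : ∀ p q, 0 ≤ N p q) (hMw : M *ᵥ w = w) (hNw : N *ᵥ w = w)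
    (hw : ∀ p, 0 < w p) (ht0 : 0 ≤ t) (ht : 2 * t < 1) (hC : C.PosSemidef)
    (hX : X = C + t • (M * X * Mᵀ + N * X * Nᵀ)) : X.PosSemidef := by
  let c : ℝ := ∑ p, ∑ q, |X p q| / (w p * w q)
  have hc (p q : ι) : |X p q| ≤ c * (w p * w q) := by
    have hpos (p q : ι) : 0 ≤ |X p q| / (w p * w q) := by
      have := hw p; have := hw q; positivity
    rw [← div_le_iff₀ (mul_pos (hw p) (hw q))]
    exact (Finset.single_le_sum (f := fun q => |X p q| / (w p * w q)) (fun q _ => hpos p q)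
      (Finset.mem_univ q)).trans (Finset.single_le_sum
        (f := fun p => ∑ q, |X p q| / (w p * w q))
        (fun p _ => Finset.sum_nonneg fun q _ => hpos p q) (Finset.mem_univ p))
  have approx (k : ℕ) : ∃ Z : Matrix ι ι ℝ, Z.PosSemidef ∧
      ∀ p q, |(Z - X) p q| ≤ (2 * t) ^ k * c * (w p * w q) := by
    induction k with
    | zero => exact ⟨0, .zero, by simpa using hc⟩
    | succ k ih =>
      obtain ⟨Z, hZ, hZX⟩ := ih
      refine ⟨C + t • (M * Z * Mᵀ + N * Z * Nᵀ), hC.add (.smul (.add ?_ ?_) ht0), fun p q => ?_⟩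
      · simpa using hZ.mul_mul_conjTranspose_same M
      · simpa using hZ.mul_mul_conjTranspose_same N
      · have h : C + t • (M * Z * Mᵀ + N * Z * Nᵀ) - X =
            t • (M * (Z - X) * Mᵀ + N * (Z - X) * Nᵀ) := by
          nth_rewrite 1 [hX]
          simp only [Matrix.mul_sub, Matrix.sub_mul, smul_add, smul_sub]
          abel
        rw [h, Matrix.smul_apply, Matrix.add_apply, smul_eq_mul, abs_mul, abs_of_nonneg ht0]
        have h₁ := abs_mul_mul_transpose_apply_le hM hMw hZX p q
        have h₂ := abs_mul_mul_transpose_apply_le hN hNw hZX p q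
        calc t * |_ + _| ≤ t * (_ + _) := by
              gcongr
              exact (abs_add_le _ _).trans (add_le_add h₁ h₂)
          _ = _ := by ring
  choose Z hZ hZX using approx
  refine posSemidef_of_tendsto hZ (tendsto_pi_nhds.2 fun p => tendsto_pi_nhds.2 fun q => ?_)
  rw [tendsto_iff_norm_sub_tendsto_zero]
  refine squeeze_zero (fun _ => norm_nonneg _) (fun k => hZX k p q) ?_
  simpa using ((tendsto_pow_atTop_nhds_zero_of_lt_one (by positivity) ht).mul_const c).mul_const
    (w p * w q)

/-! ### The normalized membership matrix -/

section Membership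

variable {n r : ℕ} {blk : Fin n → Fin r}

theorem blockSize_pos (hblk : Function.Surjective blk) (p : Fin r) : 0 < blockSize blk p := by
  obtain ⟨i, hi⟩ := hblk p
  exact Finset.card_pos.2 ⟨i, by simp [hi]⟩

theorem sqrt_blockSize_pos (hblk : Function.Surjective blk) (p : Fin r) :
    0 < √(blockSize blk p : ℝ) :=
  Real.sqrt_pos.2 (Nat.cast_pos.2 (blockSize_pos hblk p))

theorem Theta_nonneg (i : Fin n) (p : Fin r) : 0 ≤ Theta blk i p := by
  rw [Theta, of_apply]
  split_ifs <;> positivity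

theorem Theta_apply_self_pos (hblk : Function.Surjective blk) (i : Fin n) :
    0 < Theta blk i (blk i) := by
  simpa [Theta] using blockSize_pos hblk (blk i)

theorem Theta_mulVec_sqrt (hblk : Function.Surjective blk) :
    Theta blk *ᵥ (fun p => √(blockSize blk p : ℝ)) = 1 := by
  ext i
  simp [Theta, mulVec, dotProduct, (sqrt_blockSize_pos hblk (blk i)).ne']

theorem Theta_transpose_mulVec_one :
    (Theta blk)ᵀ *ᵥ 1 = fun p => √(blockSize blk p : ℝ) := by
  ext p
  simp only [Theta, mulVec, dotProduct, transpose_apply, of_apply, Pi.one_apply, mul_one]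
  rw [← Finset.sum_filter, Finset.sum_const, nsmul_eq_mul, ← div_eq_mul_inv]
  exact Real.div_sqrt

theorem isUnit_Theta_transpose_mul_diagonal_mul_Theta (hblk : Function.Surjective blk)
    {f : Fin n → ℝ} (hf : ∀ i, 0 < f i) :
    IsUnit ((Theta blk)ᵀ * diagonal f * Theta blk) := by
  have h : (Theta blk)ᵀ * diagonal f * Theta blk =
      diagonal fun p => ∑ i, Theta blk i p * f i * Theta blk i p := by
    ext p q
    rw [mul_apply, diagonal_apply]
    simp only [mul_diagonal, transpose_apply]
    split_ifs with hpq
    · rw [hpq]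
    · refine Finset.sum_eq_zero fun i _ => ?_
      by_cases hi : blk i = p
      · simp [Theta, hi, hpq]
      · simp [Theta, hi]
  rw [h, isUnit_diagonal, Pi.isUnit_iff]
  intro p
  obtain ⟨i, rfl⟩ := hblk p
  refine (Finset.sum_pos' (fun j _ => ?_) ⟨i, Finset.mem_univ i, ?_⟩).ne'.isUnit
  · exact mul_nonneg (mul_nonneg (Theta_nonneg _ _) (hf j).le) (Theta_nonneg _ _)
  · exact mul_pos (mul_pos (Theta_apply_self_pos hblk i) (hf i)) (Theta_apply_self_pos hblk i)

theorem Theta_mul_mul_transpose_apply (B : Matrix (Fin r) (Fin r) ℝ) (i j : Fin n) :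
    (Theta blk * B * (Theta blk)ᵀ) i j =
      Theta blk i (blk i) * B (blk i) (blk j) * Theta blk j (blk j) := by
  simp [mul_apply, Theta]

/-! ### Row normalization of a degree-corrected block matrix -/

theorem rowNormalize_mulVec_one {A : Matrix (Fin n) (Fin n) ℝ} (hA : ∀ i, 0 < ∑ j, A i j) :
    rowNormalize A *ᵥ 1 = 1 := by
  ext i
  simp [rowNormalize, mulVec, dotProduct, diagonal_mul, ← Finset.mul_sum, (hA i).ne']

theorem rowNormalize_nonneg {A : Matrix (Fin n) (Fin n) ℝ} (hA : ∀ i j, 0 ≤ A i j)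
    (i j : Fin n) : 0 ≤ rowNormalize A i j := by
  rw [rowNormalize, diagonal_mul]
  exact mul_nonneg (inv_nonneg.2 (Finset.sum_nonneg fun j _ => hA i j)) (hA i j)

theorem transpose_Theta_mul_mul_Theta_nonneg {P : Matrix (Fin n) (Fin n) ℝ}
    (hP : ∀ i j, 0 ≤ P i j) (p q : Fin r) : 0 ≤ ((Theta blk)ᵀ * P * Theta blk) p q := by
  simp only [mul_apply, transpose_apply]
  exact Finset.sum_nonneg fun j _ => mul_nonneg (Finset.sum_nonneg fun i _ =>
    mul_nonneg (Theta_nonneg _ _) (hP i j)) (Theta_nonneg _ _)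

theorem transpose_Theta_mul_mul_Theta_mulVec_sqrt (hblk : Function.Surjective blk)
    {P : Matrix (Fin n) (Fin n) ℝ} (hP : P *ᵥ 1 = 1) :
    ((Theta blk)ᵀ * P * Theta blk) *ᵥ (fun p => √(blockSize blk p : ℝ)) =
      fun p => √(blockSize blk p : ℝ) := by
  rw [← mulVec_mulVec, Theta_mulVec_sqrt hblk, ← mulVec_mulVec, hP, Theta_transpose_mulVec_one]

variable {B : Matrix (Fin r) (Fin r) ℝ} {d₁ d₂ : Fin n → ℝ}

theorem degreeCorrected_apply_nonneg (hB : ∀ p q, 0 ≤ B p q) (hd₁ : ∀ i, 0 < d₁ i)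
    (hd₂ : ∀ i, 0 < d₂ i) (i j : Fin n) :
    0 ≤ (diagonal d₁ * (Theta blk * B * (Theta blk)ᵀ) * diagonal d₂) i j := by
  rw [mul_diagonal, diagonal_mul, Theta_mul_mul_transpose_apply]
  exact mul_nonneg (mul_nonneg (hd₁ i).le (mul_nonneg (mul_nonneg (Theta_nonneg _ _) (hB _ _))
    (Theta_nonneg _ _))) (hd₂ j).le

theorem degreeCorrected_rowSum_pos (hblk : Function.Surjective blk) (hB : ∀ p q, 0 ≤ B p q)
    (hBrow : ∀ p, ∃ q, 0 < B p q) (hd₁ : ∀ i, 0 < d₁ i) (hd₂ : ∀ i, 0 < d₂ i) (i : Fin n) :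
    0 < ∑ j, (diagonal d₁ * (Theta blk * B * (Theta blk)ᵀ) * diagonal d₂) i j := by
  obtain ⟨q, hq⟩ := hBrow (blk i)
  obtain ⟨j, rfl⟩ := hblk q
  refine Finset.sum_pos' (fun j _ => degreeCorrected_apply_nonneg hB hd₁ hd₂ i j)
    ⟨j, Finset.mem_univ j, ?_⟩
  rw [mul_diagonal, diagonal_mul, Theta_mul_mul_transpose_apply]
  exact mul_pos (mul_pos (hd₁ i) (mul_pos (mul_pos (Theta_apply_self_pos hblk i) hq)
    (Theta_apply_self_pos hblk j))) (hd₂ j)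

theorem isUnit_transpose_Theta_mul_rowNormalize_mul_Theta (hblk : Function.Surjective blk)
    (hB : IsUnit B) {A : Matrix (Fin n) (Fin n) ℝ}
    (hA : A = diagonal d₁ * (Theta blk * B * (Theta blk)ᵀ) * diagonal d₂)
    (hsum : ∀ i, 0 < ∑ j, A i j) (hd₁ : ∀ i, 0 < d₁ i) (hd₂ : ∀ i, 0 < d₂ i) :
    IsUnit ((Theta blk)ᵀ * rowNormalize A * Theta blk) := by
  have h : (Theta blk)ᵀ * rowNormalize A * Theta blk =
      ((Theta blk)ᵀ * diagonal (fun i => (∑ j, A i j)⁻¹ * d₁ i) * Theta blk) * B *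
        ((Theta blk)ᵀ * diagonal d₂ * Theta blk) := by
    rw [rowNormalize, ← diagonal_mul_diagonal]
    nth_rewrite 2 [hA]
    simp only [Matrix.mul_assoc]
  rw [h]
  exact ((isUnit_Theta_transpose_mul_diagonal_mul_Theta hblk fun i =>
    mul_pos (inv_pos.2 (hsum i)) (hd₁ i)).mul hB).mul
      (isUnit_Theta_transpose_mul_diagonal_mul_Theta hblk hd₂)

end Membership

/-- Theorem: in the degree-corrected SBM setting (as in the paper), if in
addition the role matrix `B` is invertible, then the unique solution `X` of
`X − (β²/2)(M X Mᵀ + N X Nᵀ) = Θᵀ(PPᵀ + QQᵀ)Θ` is symmetric positive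
definite. -/
theorem reduced_equation_posDef {n r : ℕ}
    (blk : Fin n → Fin r) (hblk : Function.Surjective blk)
    (B : Matrix (Fin r) (Fin r) ℝ)
    (hBnn : ∀ p q, 0 ≤ B p q)
    (hBrow : ∀ p, ∃ q, 0 < B p q) (hBcol : ∀ q, ∃ p, 0 < B p q)
    (hBinv : IsUnit B.det)
    (d₁ d₂ : Fin n → ℝ) (hd₁ : ∀ i, 0 < d₁ i) (hd₂ : ∀ i, 0 < d₂ i)
    (A P Q : Matrix (Fin n) (Fin n) ℝ)
    (hA : A = Matrix.diagonal d₁ * (Theta blk * B * (Theta blk)ᵀ) *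
      Matrix.diagonal d₂)
    (hP : P = rowNormalize A) (hQ : Q = rowNormalize Aᵀ)
    (M N : Matrix (Fin r) (Fin r) ℝ)
    (hM : M = (Theta blk)ᵀ * P * Theta blk)
    (hN : N = (Theta blk)ᵀ * Q * Theta blk)
    (β : ℝ) (hβ : β ^ 2 < 1)
    (X : Matrix (Fin r) (Fin r) ℝ)
    (hX : X - (β ^ 2 / 2) • (M * X * Mᵀ + N * X * Nᵀ) =
      (Theta blk)ᵀ * (P * Pᵀ + Q * Qᵀ) * Theta blk) :
    X.IsSymm ∧ X.PosDef := by
  have hQA : Aᵀ = diagonal d₂ * (Theta blk * Bᵀ * (Theta blk)ᵀ) * diagonal d₁ := by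
    simp [hA, Matrix.transpose_mul, Matrix.mul_assoc]
  have hsumA (i : Fin n) : 0 < ∑ j, A i j := by
    simpa only [hA] using degreeCorrected_rowSum_pos hblk hBnn hBrow hd₁ hd₂ i
  have hsumAT (i : Fin n) : 0 < ∑ j, Aᵀ i j := by
    simpa only [hQA] using degreeCorrected_rowSum_pos (B := Bᵀ) hblk (fun p q => hBnn q p) hBcol
      hd₂ hd₁ i
  have hP_nonneg : ∀ i j, 0 ≤ P i j := hP ▸ rowNormalize_nonneg fun i j => by
    simpa only [hA] using degreeCorrected_apply_nonneg hBnn hd₁ hd₂ i j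
  have hQ_nonneg : ∀ i j, 0 ≤ Q i j := hQ ▸ rowNormalize_nonneg fun i j => by
    simpa only [hQA] using
      degreeCorrected_apply_nonneg (B := Bᵀ) (fun p q => hBnn q p) hd₂ hd₁ i j
  have hP_one : P *ᵥ 1 = 1 := hP ▸ rowNormalize_mulVec_one hsumA
  have hQ_one : Q *ᵥ 1 = 1 := hQ ▸ rowNormalize_mulVec_one hsumAT
  have hM_unit : IsUnit M := by
    rw [hM, hP]
    exact isUnit_transpose_Theta_mul_rowNormalize_mul_Theta hblk
      ((isUnit_iff_isUnit_det B).2 hBinv) hA hsumA hd₁ hd₂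
  have hC : ((Theta blk)ᵀ * (P * Pᵀ + Q * Qᵀ) * Theta blk).PosDef := by
    have hinj : Function.Injective ((Theta blk)ᵀ * P).vecMul := fun u v huv => by
      refine vecMul_injective_of_isUnit hM_unit ?_
      simpa only [hM, vecMul_vecMul] using congrArg (· ᵥ* Theta blk) huv
    have h := (PosDef.mul_conjTranspose_self _ hinj).add_posSemidef
      (posSemidef_self_mul_conjTranspose ((Theta blk)ᵀ * Q))
    simpa only [conjTranspose_eq_transpose_of_trivial, Matrix.transpose_mul, transpose_transpose,
      Matrix.mul_add, Matrix.add_mul, Matrix.mul_assoc] using h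
  have hX_eq : X = (Theta blk)ᵀ * (P * Pᵀ + Q * Qᵀ) * Theta blk +
      (β ^ 2 / 2) • (M * X * Mᵀ + N * X * Nᵀ) := eq_add_of_sub_eq hX
  have hX_psd : X.PosSemidef := by
    refine posSemidef_of_eq_add_smul (w := fun p => √(blockSize blk p : ℝ)) ?_ ?_ ?_ ?_
      (sqrt_blockSize_pos hblk) (by positivity) (by linarith) hC.posSemidef hX_eq
    · exact hM ▸ transpose_Theta_mul_mul_Theta_nonneg hP_nonneg
    · exact hN ▸ transpose_Theta_mul_mul_Theta_nonneg hQ_nonneg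
    · exact hM ▸ transpose_Theta_mul_mul_Theta_mulVec_sqrt hblk hP_one
    · exact hN ▸ transpose_Theta_mul_mul_Theta_mulVec_sqrt hblk hQ_one
  have hX_pd : X.PosDef := by
    rw [hX_eq]
    refine hC.add_posSemidef (.smul (.add ?_ ?_) (by positivity))
    · simpa using hX_psd.mul_mul_conjTranspose_same M
    · simpa using hX_psd.mul_mul_conjTranspose_same N
  exact ⟨isHermitian_iff_isSymm.1 hX_pd.isHermitian, hX_pd⟩
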